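/- Let d ≥ 1, T > 0, and let γ ≠ 0 be a real number. Let u₁, u₂ : ℝ × ℝ^d → ℝ be smooth functions with u₁(t,·) and u₂(t,·) supported in a fixed compact set K ⊂ ℝ^d for every t ∈ [0,T], and let f : ℝ × ℝ^d → ℝ be continuous. Suppose that for i = 1, 2 and all (t,x) ∈ [0,T] × ℝ^d: ∂u_i/∂t(t,x) = (∫_{ℝ^d} u_i(t,y)² dy)^γ Δu_i(t,x) + f(t,x), that u₁(0,·) = u₂(0,·), that there are constants 0 < m ≤ M with m ≤ ∫_{ℝ^d} u_i(t,y)² dy ≤ M for i = 1, 2 and all t ∈ [0,T], and that there is a constant C₀ with ∫_{ℝ^d} |∇u₂(t,y)|² dy ≤ C₀ for all t ∈ [0,T]. Then u₁(t,x) = u₂(t,x) for all (t,x) ∈ [0,T] × ℝ^d. -/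

import Mathlib

open MeasureTheory Set Function

/-- The spatial Laplacian `Δg = Σᵢ ∂²g/∂xᵢ²` of a function on `ℝ^d`. -/
noncomputable def lap {d : ℕ} (g : EuclideanSpace ℝ (Fin d) → ℝ)
    (x : EuclideanSpace ℝ (Fin d)) : ℝ :=
  ∑ i : Fin d, fderiv ℝ (fun y => fderiv ℝ g y (EuclideanSpace.single i 1)) x
    (EuclideanSpace.single i 1)

lemma aux_Dx {d : ℕ} {u : ℝ → EuclideanSpace ℝ (Fin d) → ℝ}
    (hu : ContDiff ℝ (⊤ : ℕ∞) (uncurry u)) (v : EuclideanSpace ℝ (Fin d)) :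
    ContDiff ℝ (⊤ : ℕ∞) (uncurry fun t x => fderiv ℝ (u t) x v) := by
  have h : ContDiff ℝ (⊤ : ℕ∞)
      (uncurry fun (p : ℝ × EuclideanSpace ℝ (Fin d)) (y : EuclideanSpace ℝ (Fin d)) => u p.1 y) :=
    hu.comp (by fun_prop : ContDiff ℝ (⊤ : ℕ∞) fun q : (ℝ × EuclideanSpace ℝ (Fin d)) ×
      EuclideanSpace ℝ (Fin d) => (q.1.1, q.2))
  exact ContDiff.fderiv_apply h contDiff_snd contDiff_const (by simp)

lemma aux_Dt {d : ℕ} {u : ℝ → EuclideanSpace ℝ (Fin d) → ℝ}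
    (hu : ContDiff ℝ (⊤ : ℕ∞) (uncurry u)) :
    ContDiff ℝ (⊤ : ℕ∞) (uncurry fun t x => deriv (fun s => u s x) t) := by
  have h : ContDiff ℝ (⊤ : ℕ∞)
      (uncurry fun (p : ℝ × EuclideanSpace ℝ (Fin d)) (s : ℝ) => u s p.2) :=
    hu.comp (by fun_prop : ContDiff ℝ (⊤ : ℕ∞) fun q : (ℝ × EuclideanSpace ℝ (Fin d)) × ℝ =>
      (q.2, q.1.2))
  exact ContDiff.fderiv_apply h contDiff_fst (contDiff_const (c := (1 : ℝ))) (by simp)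

lemma aux_lap_cont {d : ℕ} {u : ℝ → EuclideanSpace ℝ (Fin d) → ℝ}
    (hu : ContDiff ℝ (⊤ : ℕ∞) (uncurry u)) : Continuous (uncurry fun t x => lap (u t) x) := by
  have : (uncurry fun t x => lap (u t) x) = fun p => ∑ i : Fin d,
      (uncurry fun t x => fderiv ℝ (fun y => fderiv ℝ (u t) y (EuclideanSpace.single i 1)) x
        (EuclideanSpace.single i 1)) p := by
    ext p; rfl
  rw [this]
  exact continuous_finsetSum _ fun i _ => (aux_Dx (aux_Dx hu _) _).continuous

lemma aux_slice {d : ℕ} {u : ℝ → EuclideanSpace ℝ (Fin d) → ℝ}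
    (hu : ContDiff ℝ (⊤ : ℕ∞) (uncurry u)) (t : ℝ) : ContDiff ℝ (⊤ : ℕ∞) (u t) :=
  hu.comp (by fun_prop : ContDiff ℝ (⊤ : ℕ∞) fun x : EuclideanSpace ℝ (Fin d) => (t, x))

lemma aux_Dg {d : ℕ} {g : EuclideanSpace ℝ (Fin d) → ℝ}
    (hg : ContDiff ℝ (⊤ : ℕ∞) g) (v : EuclideanSpace ℝ (Fin d)) :
    ContDiff ℝ (⊤ : ℕ∞) (fun x => fderiv ℝ g x v) :=
  aux_slice (aux_Dx (u := fun _ => g) (hg.comp contDiff_snd) v) 0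

lemma aux_lap_sub {d : ℕ} {g h : EuclideanSpace ℝ (Fin d) → ℝ}
    (hg : ContDiff ℝ (⊤ : ℕ∞) g) (hh : ContDiff ℝ (⊤ : ℕ∞) h) (x) :
    lap (fun y => g y - h y) x = lap g x - lap h x := by
  unfold lap
  rw [← Finset.sum_sub_distrib]
  refine Finset.sum_congr rfl fun i _ => ?_
  have h1 : (fun y => fderiv ℝ (fun y => g y - h y) y (EuclideanSpace.single i 1)) =
      fun y => fderiv ℝ g y (EuclideanSpace.single i 1) -
        fderiv ℝ h y (EuclideanSpace.single i 1) := by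
    ext y
    rw [fderiv_fun_sub (hg.differentiable (by simp) y) (hh.differentiable (by simp) y)]
    rfl
  rw [h1, fderiv_fun_sub ((aux_Dg hg _).differentiable (by simp) x)
    ((aux_Dg hh _).differentiable (by simp) x)]
  rfl

lemma aux_ibp {d : ℕ} {w : EuclideanSpace ℝ (Fin d) → ℝ}
    (hw : ContDiff ℝ (⊤ : ℕ∞) w) (hc : HasCompactSupport w) :
    ∫ x, w x * lap w x ≤ 0 := by
  unfold lap
  simp_rw [Finset.mul_sum]
  have hi : ∀ v : EuclideanSpace ℝ (Fin d),
      Integrable fun x => w x * fderiv ℝ (fun y => fderiv ℝ w y v) x v := fun v =>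
    Continuous.integrable_of_hasCompactSupport
      (hw.continuous.mul (aux_Dg (aux_Dg hw v) v).continuous) hc.mul_right
  rw [integral_finsetSum _ fun i _ => hi _]
  refine Finset.sum_nonpos fun i _ => ?_
  rw [integral_mul_fderiv_eq_neg_fderiv_mul_of_integrable]
  · rw [neg_nonpos]
    exact integral_nonneg fun x => mul_self_nonneg _
  · exact Continuous.integrable_of_hasCompactSupport
      ((aux_Dg hw _).continuous.mul (aux_Dg hw _).continuous)
      (HasCompactSupport.mul_right (hc.fderiv_apply ℝ _))
  · exact hi _
  · exact Continuous.integrable_of_hasCompactSupport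
      (hw.continuous.mul (aux_Dg hw _).continuous) hc.mul_right
  · exact fun x _ => hw.differentiable (by simp) x
  · exact fun x _ => (aux_Dg hw _).differentiable (by simp) x

lemma aux_rpow_lip (γ m M : ℝ) (hm : 0 < m) : ∃ L, 0 ≤ L ∧ ∀ a ∈ Icc m M, ∀ b ∈ Icc m M,
    |a ^ γ - b ^ γ| ≤ L * |a - b| := by
  have hc : ContinuousOn (fun s : ℝ => γ * s ^ (γ - 1)) (Icc m M) := by
    refine continuousOn_const.mul (continuousOn_id.rpow_const fun x hx => Or.inl ?_)
    exact (hm.trans_le hx.1).ne'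
  obtain ⟨L, hL⟩ := isCompact_Icc.exists_bound_of_continuousOn hc
  refine ⟨|L|, abs_nonneg _, fun a ha b hb => ?_⟩
  refine Convex.norm_image_sub_le_of_norm_hasDerivWithin_le (f := fun s : ℝ => s ^ γ)
    (f' := fun s : ℝ => γ * s ^ (γ - 1)) (s := Icc m M) ?_
    (fun x hx => (hL x hx).trans (le_abs_self L)) (convex_Icc m M) hb ha
  intro x hx
  exact (Real.hasDerivAt_rpow_const (Or.inl (hm.trans_le hx.1).ne')).hasDerivWithinAt

lemma aux_cs {d : ℕ} {K : Set (EuclideanSpace ℝ (Fin d))} (hK : IsCompact K)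
    {w : EuclideanSpace ℝ (Fin d) → ℝ} (hw : Continuous w) :
    (∫ x in K, |w x|) ^ 2 ≤ (volume K).toReal * ∫ x in K, (w x) ^ 2 := by
  have h1 : IntegrableOn (fun x => |w x|) K := hw.abs.continuousOn.integrableOn_compact hK
  have h2 : IntegrableOn (fun x => (w x) ^ 2) K := (hw.pow 2).continuousOn.integrableOn_compact hK
  have h3 : IntegrableOn (fun _ : EuclideanSpace ℝ (Fin d) => (1 : ℝ)) K :=
    continuous_const.continuousOn.integrableOn_compact hK
  have key : ∀ c : ℝ, 0 ≤ (volume K).toReal * (c * c) + (-2 * ∫ x in K, |w x|) * c +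
      ∫ x in K, (w x) ^ 2 := by
    intro c
    have : ∫ x in K, (|w x| - c) ^ 2 = (volume K).toReal * (c * c) + (-2 * ∫ x in K, |w x|) * c +
      ∫ x in K, (w x) ^ 2 := by
      have e : (fun x => (|w x| - c) ^ 2) = fun x => (c * c) * (1 : ℝ) + (-2 * c) * |w x| +
          (w x) ^ 2 := by
        ext x; rw [← sq_abs (w x)]; ring
      have h4 : IntegrableOn (fun x => (c * c) * (1 : ℝ) + (-2 * c) * |w x|) K :=
        (h3.const_mul _).add (h1.const_mul _)
      rw [e, integral_add h4 h2,
        integral_add (h3.const_mul _) (h1.const_mul _), integral_const_mul, integral_const_mul]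
      simp [Measure.real]
      ring
    rw [← this]
    exact integral_nonneg fun x => sq_nonneg _
  have := discrim_le_zero key
  unfold discrim at this
  nlinarith

lemma aux_energy {d : ℕ} {K : Set (EuclideanSpace ℝ (Fin d))} (hK : IsCompact K)
    {w : ℝ → EuclideanSpace ℝ (Fin d) → ℝ} (hw : ContDiff ℝ (⊤ : ℕ∞) (uncurry w)) (t : ℝ) :
    HasDerivAt (fun s => ∫ x in K, (w s x) ^ 2)
      (∫ x in K, 2 * w t x * deriv (fun s => w s x) t) t := by
  have hD := (aux_Dt hw).continuous
  have hc : Continuous fun p : ℝ × EuclideanSpace ℝ (Fin d) =>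
      2 * w p.1 p.2 * deriv (fun s => w s p.2) p.1 :=
    (continuous_const.mul hw.continuous).mul hD
  obtain ⟨B, hB⟩ := ((isCompact_Icc (a := t - 1) (b := t + 1)).prod hK).exists_bound_of_continuousOn
    hc.continuousOn
  have hfin : IsFiniteMeasure (volume.restrict K) := ⟨by simpa using hK.measure_lt_top⟩
  refine (hasDerivAt_integral_of_dominated_loc_of_deriv_le (s := Icc (t - 1) (t + 1))
    (F := fun s x => (w s x) ^ 2)
    (F' := fun s x => 2 * w s x * deriv (fun s => w s x) s) (bound := fun _ => B)
    (Icc_mem_nhds (by linarith) (by linarith)) ?_ ?_ ?_ ?_ (integrable_const B) ?_).2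
  · exact Filter.Eventually.of_forall fun s =>
      ((aux_slice hw s).continuous.pow 2).aestronglyMeasurable
  · exact ((aux_slice hw t).continuous.pow 2).continuousOn.integrableOn_compact hK
  · exact (hc.comp (by fun_prop : Continuous fun x : EuclideanSpace ℝ (Fin d) => (t, x))).aestronglyMeasurable
  · filter_upwards [ae_restrict_mem hK.measurableSet] with x hx s hs
    exact hB (s, x) ⟨hs, hx⟩
  · refine Filter.Eventually.of_forall fun x s _ => ?_
    have : HasDerivAt (fun s => w s x) (deriv (fun s => w s x) s) s := by
      refine DifferentiableAt.hasDerivAt ?_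
      have : ContDiff ℝ (⊤ : ℕ∞) (fun s => w s x) :=
        hw.comp (by fun_prop : ContDiff ℝ (⊤ : ℕ∞) fun s : ℝ => (s, x))
      exact this.differentiable (by simp) s
    exact (this.fun_pow 2).congr_deriv (by norm_num)

/-- **uniqueness.** Two smooth, compactly supported (in space) solutions of
`∂u/∂t = (∫ u²)^γ Δu + f` on `[0,T] × ℝ^d` with the same initial data, whose squared `L²`-norms
stay in `[m,M]` with `0 < m ≤ M`, and with `∫ |∇u₂(t)|² ≤ C₀` bounded, coincide on
`[0,T] × ℝ^d`. -/
theorem stmt15 (d : ℕ) (hd : 1 ≤ d) (T : ℝ) (hT : 0 < T) (γ : ℝ) (hγ : γ ≠ 0)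
    (u₁ u₂ : ℝ → EuclideanSpace ℝ (Fin d) → ℝ)
    (hu₁ : ContDiff ℝ (⊤ : ℕ∞) (uncurry u₁)) (hu₂ : ContDiff ℝ (⊤ : ℕ∞) (uncurry u₂))
    (K : Set (EuclideanSpace ℝ (Fin d))) (hK : IsCompact K)
    (hsupp₁ : ∀ t ∈ Icc 0 T, support (u₁ t) ⊆ K)
    (hsupp₂ : ∀ t ∈ Icc 0 T, support (u₂ t) ⊆ K)
    (f : ℝ → EuclideanSpace ℝ (Fin d) → ℝ) (hf : Continuous (uncurry f))
    (heq₁ : ∀ t ∈ Icc 0 T, ∀ x, deriv (fun s => u₁ s x) t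
      = (∫ y, (u₁ t y) ^ 2) ^ γ * lap (u₁ t) x + f t x)
    (heq₂ : ∀ t ∈ Icc 0 T, ∀ x, deriv (fun s => u₂ s x) t
      = (∫ y, (u₂ t y) ^ 2) ^ γ * lap (u₂ t) x + f t x)
    (hinit : u₁ 0 = u₂ 0)
    (m M : ℝ) (hm : 0 < m) (hmM : m ≤ M)
    (hb₁ : ∀ t ∈ Icc 0 T, m ≤ (∫ y, (u₁ t y) ^ 2) ∧ (∫ y, (u₁ t y) ^ 2) ≤ M)
    (hb₂ : ∀ t ∈ Icc 0 T, m ≤ (∫ y, (u₂ t y) ^ 2) ∧ (∫ y, (u₂ t y) ^ 2) ≤ M)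
    (C₀ : ℝ) (hgrad : ∀ t ∈ Icc 0 T, (∫ y, ‖gradient (u₂ t) y‖ ^ 2) ≤ C₀) :
    ∀ t ∈ Icc 0 T, ∀ x, u₁ t x = u₂ t x := by
  have hw : ContDiff ℝ (⊤ : ℕ∞) (uncurry fun t x => u₁ t x - u₂ t x) := hu₁.sub hu₂
  have hdiff : ∀ {u : ℝ → EuclideanSpace ℝ (Fin d) → ℝ}, ContDiff ℝ (⊤ : ℕ∞) (uncurry u) →
      ∀ x t, DifferentiableAt ℝ (fun s => u s x) t := by
    intro u hu x t
    have : ContDiff ℝ (⊤ : ℕ∞) (fun s => u s x) :=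
      hu.comp (by fun_prop : ContDiff ℝ (⊤ : ℕ∞) fun s : ℝ => (s, x))
    exact this.differentiable (by simp) t
  have hz : ∀ t ∈ Icc 0 T, ∀ x, x ∉ K → u₁ t x = 0 ∧ u₂ t x = 0 := fun t ht x hx =>
    ⟨by_contra fun h => hx (hsupp₁ t ht h), by_contra fun h => hx (hsupp₂ t ht h)⟩
  have hsK : ∀ (g : EuclideanSpace ℝ (Fin d) → ℝ), (∀ x, x ∉ K → g x = 0) →
      ∫ x in K, g x = ∫ x, g x := fun g hg => setIntegral_eq_integral_of_forall_compl_eq_zero hg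
  obtain ⟨L, hL0, hL⟩ := aux_rpow_lip γ m M hm
  have hcK := (isCompact_Icc (a := (0 : ℝ)) (b := T)).prod hK
  obtain ⟨B, hB⟩ := hcK.exists_bound_of_continuousOn (aux_lap_cont hu₂).continuousOn
  obtain ⟨B', hB'⟩ := hcK.exists_bound_of_continuousOn (hu₁.continuous.add hu₂.continuous).continuousOn
  -- lower-order bounds
  set A : ℝ → ℝ := fun t => ∫ x in K, |u₁ t x - u₂ t x| with hA
  set E : ℝ → ℝ := fun t => ∫ x in K, (u₁ t x - u₂ t x) ^ 2 with hE
  have hA0 : ∀ t, 0 ≤ A t := fun t => integral_nonneg fun x => abs_nonneg _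
  have hwc : ∀ t, Continuous fun x => u₁ t x - u₂ t x := fun t => (aux_slice hw t).continuous
  have hmulbd : ∀ t (g : EuclideanSpace ℝ (Fin d) → ℝ) (b : ℝ), (∀ x ∈ K, |g x| ≤ b) →
      |∫ x in K, (u₁ t x - u₂ t x) * g x| ≤ |b| * A t := by
    intro t g b hg
    rw [hA, ← integral_const_mul, ← Real.norm_eq_abs]
    refine norm_integral_le_of_norm_le
      (((hwc t).abs.continuousOn.integrableOn_compact hK).const_mul _) ?_
    filter_upwards [ae_restrict_mem hK.measurableSet] with x hx
    rw [Real.norm_eq_abs, abs_mul, mul_comm]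
    exact mul_le_mul_of_nonneg_right ((hg x hx).trans (le_abs_self b)) (abs_nonneg _)
  have hder : ∀ t ∈ Icc 0 T, (∫ x in K, 2 * (u₁ t x - u₂ t x) * deriv (fun s => u₁ s x - u₂ s x) t)
      ≤ (2 * (L * |B'| * |B|) * (volume K).toReal) * E t := by
    intro t ht
    set a₁ := ∫ y, (u₁ t y) ^ 2 with ha₁
    set a₂ := ∫ y, (u₂ t y) ^ 2 with ha₂
    have c1 := (aux_slice hu₁ t)
    have c2 := (aux_slice hu₂ t)
    have hlc : ∀ {u : ℝ → EuclideanSpace ℝ (Fin d) → ℝ}, ContDiff ℝ (⊤ : ℕ∞) (uncurry u) →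
        Continuous fun x => lap (u t) x := fun hu => (aux_lap_cont hu).comp
          (by fun_prop : Continuous fun x : EuclideanSpace ℝ (Fin d) => (t, x))
    have e : (fun x => 2 * (u₁ t x - u₂ t x) * deriv (fun s => u₁ s x - u₂ s x) t) =
        fun x => (2 * a₁ ^ γ) * ((u₁ t x - u₂ t x) * lap (fun y => u₁ t y - u₂ t y) x) +
          (2 * (a₁ ^ γ - a₂ ^ γ)) * ((u₁ t x - u₂ t x) * lap (u₂ t) x) := by
      ext x
      rw [deriv_fun_sub (hdiff hu₁ x t) (hdiff hu₂ x t), heq₁ t ht x, heq₂ t ht x,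
        aux_lap_sub c1 c2]
      ring
    have i1 : IntegrableOn (fun x => (u₁ t x - u₂ t x) * lap (fun y => u₁ t y - u₂ t y) x) K :=
      ((hwc t).mul (hlc hw)).continuousOn.integrableOn_compact hK
    have i2 : IntegrableOn (fun x => (u₁ t x - u₂ t x) * lap (u₂ t) x) K :=
      ((hwc t).mul (hlc hu₂)).continuousOn.integrableOn_compact hK
    rw [e, integral_add (i1.const_mul _) (i2.const_mul _), integral_const_mul, integral_const_mul]
    have n1 : ∫ x in K, (u₁ t x - u₂ t x) * lap (fun y => u₁ t y - u₂ t y) x ≤ 0 := by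
      rw [hsK _ fun x hx => by simp [hz t ht x hx]]
      exact aux_ibp (c1.sub c2) (HasCompactSupport.intro hK fun x hx => by simp [hz t ht x hx])
    have n2 := hmulbd t (lap (u₂ t)) B fun x hx => hB (t, x) ⟨ht, hx⟩
    have n3 := hmulbd t (fun x => u₁ t x + u₂ t x) B' fun x hx => hB' (t, x) ⟨ht, hx⟩
    have j1 : IntegrableOn (fun y => u₁ t y ^ 2) K :=
      (c1.continuous.pow 2).continuousOn.integrableOn_compact hK
    have j2 : IntegrableOn (fun y => u₂ t y ^ 2) K :=
      (c2.continuous.pow 2).continuousOn.integrableOn_compact hK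
    have n4 : ∫ x in K, (u₁ t x - u₂ t x) * (u₁ t x + u₂ t x) = a₁ - a₂ := by
      rw [ha₁, ha₂, ← hsK (fun y => u₁ t y ^ 2) fun x hx => by simp [hz t ht x hx],
        ← hsK (fun y => u₂ t y ^ 2) fun x hx => by simp [hz t ht x hx],
        ← integral_sub j1 j2]
      congr 1; ext x; ring
    rw [n4] at n3
    have n5 := hL a₁ (hb₁ t ht) a₂ (hb₂ t ht)
    have n6 : |a₁ ^ γ - a₂ ^ γ| ≤ L * (|B'| * A t) := n5.trans (mul_le_mul_of_nonneg_left n3 hL0)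
    have n7 : (A t) ^ 2 ≤ (volume K).toReal * E t := aux_cs hK (hwc t)
    have n8 : 0 ≤ a₁ ^ γ := Real.rpow_nonneg (hm.le.trans (hb₁ t ht).1) γ
    have n9 := mul_le_mul n6 n2 (abs_nonneg _) (mul_nonneg hL0 (mul_nonneg (abs_nonneg _) (hA0 t)))
    rw [← abs_mul] at n9
    have n10 := (le_abs_self _).trans n9
    have n11 := mul_le_mul_of_nonneg_left n7 (by positivity : 0 ≤ L * |B'| * |B|)
    have n12 := mul_nonneg n8 (neg_nonneg.2 n1)
    nlinarith
  have hEd : ∀ t, HasDerivAt E _ t := fun t => aux_energy hK hw t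
  have hE0 : E 0 = 0 := by simp [hE, hinit]
  have hgr := le_gronwallBound_of_liminf_deriv_right_le (f := E) (δ := 0) (ε := 0) (a := 0) (b := T)
    (fun t _ => (hEd t).continuousAt.continuousWithinAt)
    (fun t _ r hr => (hEd t).hasDerivWithinAt.liminf_right_slope_le hr) hE0.le
    (fun t ht => by rw [add_zero]; exact hder t ⟨ht.1, ht.2.le⟩)
  intro t ht x
  have h0 : E t ≤ 0 := by simpa [gronwallBound_ε0] using hgr t ht
  have h1 : ∫ x, (u₁ t x - u₂ t x) ^ 2 = 0 := by
    rw [← hsK _ fun x hx => by simp [hz t ht x hx]]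
    exact le_antisymm h0 (integral_nonneg fun x => sq_nonneg _)
  have hc2 : Continuous fun x => (u₁ t x - u₂ t x) ^ 2 := (hwc t).pow 2
  have hi : Integrable fun x => (u₁ t x - u₂ t x) ^ 2 :=
    hc2.integrable_of_hasCompactSupport
      (HasCompactSupport.intro hK fun x hx => by simp [hz t ht x hx])
  have h2 := (integral_eq_zero_iff_of_nonneg (fun x => sq_nonneg _) hi).1 h1
  have h3 := congrFun ((Continuous.ae_eq_iff_eq volume hc2 continuous_zero).1 h2) x
  have h4 : (u₁ t x - u₂ t x) ^ 2 = 0 := h3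
  exact sub_eq_zero.1 (pow_eq_zero_iff (by norm_num) |>.1 h4)
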